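/- arXiv:1903.04734 — 4 statements merged into one kernel-verified Lean document; each statement's English description precedes it below -/
import Mathlib

section
/- Let L be the Laplacian of a weight-balanced weighted digraph on N vertices, let σᵢ ∈ (0,1) for each i, fix a constant x̄ ∈ ℝ and a vector x̂ ∈ ℝ^N, and write ẑᵢ = Σⱼ wᵢⱼ (x̂ᵢ - x̂ⱼ) and φ̂ᵢ = Σⱼ wᵢⱼ (x̂ᵢ - x̂ⱼ)². Suppose x, χ : ℝ → ℝ^N are differentiable on an interval I and satisfy, for all t ∈ I, xᵢ'(t) = -ẑᵢ and χᵢ'(t) = σᵢ φ̂ᵢ + 2 (xᵢ(t) - x̂ᵢ) ẑᵢ for every i. Then the Lyapunov function V(t) = Σᵢ (xᵢ(t) - x̄)² + Σᵢ χᵢ(t) satisfies V'(t) = -Σᵢ (1 - σᵢ) φ̂ᵢ ≤ 0 for all t ∈ I; in particular V is nonincreasing on I. -/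
open scoped BigOperators

/-- In a weight-balanced digraph, the weighted differences of any potential sum to zero. -/
theorem sum_weight_mul_sub_eq_zero {ι : Type*} [Fintype ι] {w : ι → ι → ℝ}
    (hbal : ∀ i, ∑ j, w i j = ∑ j, w j i) (f : ι → ℝ) :
    ∑ i, ∑ j, w i j * (f i - f j) = 0 := by
  simp only [mul_sub, Finset.sum_sub_distrib]
  rw [Finset.sum_comm (f := fun i j => w i j * f j)]
  simp only [← Finset.sum_mul, hbal, sub_self]

/-- In a weight-balanced digraph, `2 xᵀ L x` is the total weighted squared disagreement of `x`. -/
theorem two_mul_sum_mul_laplacian_eq {ι : Type*} [Fintype ι] {w : ι → ι → ℝ}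
    (hbal : ∀ i, ∑ j, w i j = ∑ j, w j i) (x : ι → ℝ) :
    2 * ∑ i, x i * ∑ j, w i j * (x i - x j) = ∑ i, ∑ j, w i j * (x i - x j) ^ 2 := by
  rw [← sub_eq_zero, ← sum_weight_mul_sub_eq_zero hbal fun i => x i ^ 2]
  simp only [Finset.mul_sum, ← Finset.sum_sub_distrib]
  refine Finset.sum_congr rfl fun i _ => Finset.sum_congr rfl fun j _ => ?_
  ring

/-- Between events (with `x̂` constant), under the flow dynamics
`xᵢ' = -ẑᵢ`, `χᵢ' = σᵢ φ̂ᵢ + 2 eᵢ ẑᵢ`, the Lyapunov function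
`V(t) = ∑ᵢ (xᵢ(t) - x̄)² + ∑ᵢ χᵢ(t)` has derivative `-∑ᵢ (1 - σᵢ) φ̂ᵢ ≤ 0`
on the interval `I`; in particular `V` is nonincreasing on `I`. -/
theorem lyapunov_nonincreasing
    (N : ℕ) (hN : 1 ≤ N) (w : Fin N → Fin N → ℝ)
    (hw_nonneg : ∀ i j, 0 ≤ w i j) (hw_diag : ∀ i, w i i = 0)
    (hbal : ∀ i, ∑ j, w i j = ∑ j, w j i)
    (σ : Fin N → ℝ) (hσ : ∀ i, σ i ∈ Set.Ioo (0 : ℝ) 1)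
    (xbar : ℝ) (xhat : Fin N → ℝ)
    (x χ : ℝ → Fin N → ℝ)
    (I : Set ℝ) (hI : Convex ℝ I)
    (hx : ∀ t ∈ I, ∀ i, HasDerivAt (fun s => x s i)
      (-(∑ j, w i j * (xhat i - xhat j))) t)
    (hχ : ∀ t ∈ I, ∀ i, HasDerivAt (fun s => χ s i)
      (σ i * (∑ j, w i j * (xhat i - xhat j) ^ 2)
        + 2 * (x t i - xhat i) * (∑ j, w i j * (xhat i - xhat j))) t) :
    (∀ t ∈ I, HasDerivAt (fun s => (∑ i, (x s i - xbar) ^ 2) + ∑ i, χ s i)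
      (-(∑ i, (1 - σ i) * (∑ j, w i j * (xhat i - xhat j) ^ 2))) t) ∧
    (-(∑ i, (1 - σ i) * (∑ j, w i j * (xhat i - xhat j) ^ 2)) ≤ 0) ∧
    (∀ s ∈ I, ∀ t ∈ I, s ≤ t →
      (∑ i, (x t i - xbar) ^ 2) + (∑ i, χ t i)
        ≤ (∑ i, (x s i - xbar) ^ 2) + (∑ i, χ s i)) := by
  have hderiv : ∀ t ∈ I, HasDerivAt (fun s => (∑ i, (x s i - xbar) ^ 2) + ∑ i, χ s i)
      (-(∑ i, (1 - σ i) * (∑ j, w i j * (xhat i - xhat j) ^ 2))) t := by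
    intro t ht
    refine ((HasDerivAt.fun_sum fun i _ => ((hx t ht i).sub_const xbar).fun_pow 2).fun_add
      (HasDerivAt.fun_sum fun i _ => hχ t ht i)).congr_deriv ?_
    have hsum := sum_weight_mul_sub_eq_zero hbal xhat
    have hquad := two_mul_sum_mul_laplacian_eq hbal xhat
    rw [← sub_eq_zero]
    trans 2 * xbar * (∑ i, ∑ j, w i j * (xhat i - xhat j))
      - (2 * ∑ i, xhat i * ∑ j, w i j * (xhat i - xhat j))
      + ∑ i, ∑ j, w i j * (xhat i - xhat j) ^ 2
    · rw [Finset.mul_sum, Finset.mul_sum, sub_neg_eq_add]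
      simp only [← Finset.sum_add_distrib, ← Finset.sum_sub_distrib]
      refine Finset.sum_congr rfl fun i _ => ?_
      push_cast
      ring
    · rw [hsum, hquad]
      ring
  have hnonpos : -(∑ i, (1 - σ i) * (∑ j, w i j * (xhat i - xhat j) ^ 2)) ≤ 0 :=
    neg_nonpos.2 <| Finset.sum_nonneg fun i _ =>
      mul_nonneg (sub_nonneg.2 (hσ i).2.le) <| Finset.sum_nonneg fun j _ =>
        mul_nonneg (hw_nonneg i j) (sq_nonneg _)
  refine ⟨hderiv, hnonpos, ?_⟩
  exact antitoneOn_of_hasDerivWithinAt_nonpos hI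
    (fun t ht => (hderiv t ht).continuousAt.continuousWithinAt)
    (fun t ht => (hderiv t (interior_subset ht)).hasDerivWithinAt) (fun _ _ => hnonpos)
end

section
/- (Positive minimum inter-event time, Theorem 1.) Let T > 0 and let (χ, e) be a solution of the local event-clock system on [0, T] for some continuous input μ, with initial condition χ(0) = 0 and e(0) = 0 (the state immediately after a broadcast event). If χ(T) = 0 and e(T) ≠ 0 (the condition triggering the next event), then T ≥ σ/d. Hence the inter-event times of agent i under the dynamic event-triggered algorithm are lower bounded by Tᵢ = σᵢ/dᵢ > 0. -/
open scoped BigOperators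

/-- **Theorem 1: positive minimum inter-event time.**
If `(χ, e)` solves the local event-clock system on `[0, T]` for some continuous
input `μ`, starting from `χ(0) = 0`, `e(0) = 0` (just after a broadcast), and
the next event condition `χ(T) = 0`, `e(T) ≠ 0` holds at time `T > 0`, then
`T ≥ σ / d` where `d = ∑ⱼ wⱼ`. -/
theorem positive_MIET
    (m : ℕ) (hm : 1 ≤ m) (σ : ℝ) (hσ : σ ∈ Set.Ioo (0 : ℝ) 1)
    (w : Fin m → ℝ) (hw : ∀ j, 0 < w j)
    (μ : ℝ → Fin m → ℝ) (hμ : ∀ j, Continuous (fun t => μ t j))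
    (T : ℝ) (hT : 0 < T) (χ e : ℝ → ℝ)
    (hχ : ∀ t ∈ Set.Icc (0 : ℝ) T, HasDerivAt χ
      (σ * (∑ j, w j * (μ t j) ^ 2) + 2 * e t * (∑ j, w j * μ t j)) t)
    (he : ∀ t ∈ Set.Icc (0 : ℝ) T, HasDerivAt e (-(∑ j, w j * μ t j)) t)
    (hχ0 : χ 0 = 0) (he0 : e 0 = 0)
    (hχT : χ T = 0) (heT : e T ≠ 0) :
    σ / (∑ j, w j) ≤ T := by
  have hd : 0 < ∑ j, w j := by
    have : Nonempty (Fin m) := ⟨⟨0, hm⟩⟩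
    exact Finset.sum_pos (fun j _ => hw j) Finset.univ_nonempty
  set d := ∑ j, w j with hd_def
  set c := e T / T with hc
  have hg : ∀ t ∈ Set.Icc (0 : ℝ) T, HasDerivAt
      (fun t => χ t + e t ^ 2 - σ / d * (2 * c * e t - c ^ 2 * t))
      (σ * (∑ j, w j * (μ t j + c / d) ^ 2)) t := by
    intro t ht
    have hquad : ∑ j, w j * (μ t j + c / d) ^ 2 =
        ∑ j, w j * (μ t j) ^ 2 + 2 * (c / d) * (∑ j, w j * μ t j) + (c / d) ^ 2 * d := by
      rw [hd_def, Finset.mul_sum, Finset.mul_sum, ← Finset.sum_add_distrib,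
        ← Finset.sum_add_distrib]
      exact Finset.sum_congr rfl fun j _ => by ring
    refine HasDerivAt.congr_deriv (((hχ t ht).add ((he t ht).pow 2)).sub
      ((((he t ht).const_mul (2 * c)).sub ((hasDerivAt_id t).const_mul (c ^ 2))).const_mul
        (σ / d))) ?_
    rw [hquad]
    field_simp
    ring
  have hmono : MonotoneOn (fun t => χ t + e t ^ 2 - σ / d * (2 * c * e t - c ^ 2 * t))
      (Set.Icc 0 T) := by
    refine monotoneOn_of_deriv_nonneg (convex_Icc 0 T)
      (fun t ht => (hg t ht).continuousAt.continuousWithinAt)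
      (fun t ht => (hg t (interior_subset ht)).differentiableAt.differentiableWithinAt) ?_
    intro t ht
    rw [(hg t (interior_subset ht)).deriv]
    exact mul_nonneg hσ.1.le
      (Finset.sum_nonneg fun j _ => mul_nonneg (hw j).le (sq_nonneg _))
  have h := hmono (Set.left_mem_Icc.2 hT.le) (Set.right_mem_Icc.2 hT.le) hT.le
  have heT' : e T = c * T := by rw [hc]; field_simp
  have hc0 : 0 < c ^ 2 * T := by
    have : c ≠ 0 := div_ne_zero heT hT.ne'
    positivity
  simp only [hχ0, he0, hχT, heT'] at h
  refine le_of_mul_le_mul_left ?_ hc0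
  linarith
end

section
/- (Time until next event, Lemma 6.) Let T > 0 and let (χ, e) be a solution of the local event-clock system on [0, T] for some continuous input μ, with initial condition χ(0) = χ₀ ≥ 0 and e(0) = e₀ ∈ ℝ. Suppose χ(T) = 0 and e(T) ≠ 0 (the condition triggering the next event). Then: if (χ₀, e₀) ≠ (0,0), T ≥ (σ/d)(1 - e₀²/(χ₀ + e₀²)); and if (χ₀, e₀) = (0,0), T ≥ σ/d. -/
open scoped BigOperators

/-- If `k * V' ≥ (e')²` on `[0, T]`, then `(e T - e 0)² ≤ T * k * (V T - V 0)`: a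
Cauchy–Schwarz estimate that needs no integrability of the derivatives. -/
lemma sq_sub_le_of_sq_deriv_le {T k : ℝ} (hT : 0 < T) {V e V' e' : ℝ → ℝ}
    (hV : ∀ t ∈ Set.Icc (0 : ℝ) T, HasDerivAt V (V' t) t)
    (he : ∀ t ∈ Set.Icc (0 : ℝ) T, HasDerivAt e (e' t) t)
    (hle : ∀ t ∈ Set.Icc (0 : ℝ) T, (e' t) ^ 2 ≤ k * V' t) :
    (e T - e 0) ^ 2 ≤ T * k * (V T - V 0) := by
  set c : ℝ := (e T - e 0) / T with hc
  have hcT : c * T = e T - e 0 := div_mul_cancel₀ _ hT.ne'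
  have hderiv : ∀ t ∈ Set.Icc (0 : ℝ) T,
      HasDerivAt (fun t => k * V t - 2 * c * e t + c ^ 2 * t)
        (k * V' t - 2 * c * e' t + c ^ 2 * 1) t := fun t ht =>
    (((hV t ht).const_mul k).sub ((he t ht).const_mul (2 * c))).add
      ((hasDerivAt_id t).const_mul (c ^ 2))
  have hmono : MonotoneOn (fun t => k * V t - 2 * c * e t + c ^ 2 * t) (Set.Icc 0 T) := by
    refine monotoneOn_of_hasDerivWithinAt_nonneg (convex_Icc 0 T)
      (fun t ht => (hderiv t ht).continuousAt.continuousWithinAt)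
      (fun t ht => (hderiv t (interior_subset ht)).hasDerivWithinAt) fun t ht => ?_
    nlinarith [hle t (interior_subset ht), sq_nonneg (e' t - c)]
  have h := hmono (Set.left_mem_Icc.2 hT.le) (Set.right_mem_Icc.2 hT.le) hT.le
  simp only at h
  have h2 : 0 ≤ T * (k * (V T - V 0) - 2 * c * (e T - e 0) + c ^ 2 * T) :=
    mul_nonneg hT.le (by linarith)
  rw [← hcT] at h2 ⊢
  linarith

/-- **Lemma 6: time until next event.**
If `(χ, e)` solves the local event-clock system on `[0, T]` for some continuous
input `μ`, with `χ(0) = χ₀ ≥ 0` and `e(0) = e₀`, and the event condition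
`χ(T) = 0`, `e(T) ≠ 0` holds at time `T > 0`, then
`T ≥ (σ/d)(1 - e₀²/(χ₀ + e₀²))` when `(χ₀, e₀) ≠ (0,0)`, and `T ≥ σ/d` when
`(χ₀, e₀) = (0,0)`, where `d = ∑ⱼ wⱼ`. -/
theorem time_until_next_event
    (m : ℕ) (hm : 1 ≤ m) (σ : ℝ) (hσ : σ ∈ Set.Ioo (0 : ℝ) 1)
    (w : Fin m → ℝ) (hw : ∀ j, 0 < w j)
    (μ : ℝ → Fin m → ℝ) (hμ : ∀ j, Continuous (fun t => μ t j))
    (T : ℝ) (hT : 0 < T) (χ e : ℝ → ℝ)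
    (hχ : ∀ t ∈ Set.Icc (0 : ℝ) T, HasDerivAt χ
      (σ * (∑ j, w j * (μ t j) ^ 2) + 2 * e t * (∑ j, w j * μ t j)) t)
    (he : ∀ t ∈ Set.Icc (0 : ℝ) T, HasDerivAt e (-(∑ j, w j * μ t j)) t)
    (hχ0 : 0 ≤ χ 0)
    (hχT : χ T = 0) (heT : e T ≠ 0) :
    ((χ 0, e 0) ≠ ((0 : ℝ), (0 : ℝ)) →
      σ / (∑ j, w j) * (1 - (e 0) ^ 2 / (χ 0 + (e 0) ^ 2)) ≤ T) ∧
    (χ 0 = 0 → e 0 = 0 → σ / (∑ j, w j) ≤ T) := by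
  obtain ⟨hσ0, -⟩ := hσ
  have : NeZero m := ⟨by omega⟩
  have hd : 0 < ∑ j, w j := Finset.sum_pos (fun j _ => hw j) Finset.univ_nonempty
  set d := ∑ j, w j
  have hcs : ∀ t, (∑ j, w j * μ t j) ^ 2 ≤ d * ∑ j, w j * (μ t j) ^ 2 := fun t =>
    Finset.sum_sq_le_sum_mul_sum_of_sq_le_mul _ (fun j _ => (hw j).le)
      (fun j _ => mul_nonneg (hw j).le (sq_nonneg _)) (fun j _ => le_of_eq (by ring))
  have key := sq_sub_le_of_sq_deriv_le (k := d / σ) hT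
    (V := fun t => χ t + e t ^ 2) (V' := fun t => σ * ∑ j, w j * (μ t j) ^ 2)
    (fun t ht => ((hχ t ht).add ((he t ht).pow 2)).congr_deriv (by push_cast; ring))
    he (fun t _ => by
      have h : d / σ * (σ * ∑ j, w j * (μ t j) ^ 2) = d * ∑ j, w j * (μ t j) ^ 2 := by
        field_simp
      rw [neg_sq, h]
      exact hcs t)
  simp only [hχT, zero_add] at key
  have hTk : 0 < T * (d / σ) := by positivity
  constructor
  · intro hne
    have hV0 : 0 < χ 0 + e 0 ^ 2 := by
      refine lt_of_le_of_ne (by positivity) fun h => hne ?_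
      have h1 : χ 0 = 0 := by nlinarith [sq_nonneg (e 0)]
      have h2 : e 0 = 0 := by
        rw [h1, zero_add] at h
        exact pow_eq_zero_iff two_ne_zero |>.1 h.symm
      rw [h1, h2]
    have hΔ : 0 ≤ e T ^ 2 - (χ 0 + e 0 ^ 2) :=
      nonneg_of_mul_nonneg_right ((sq_nonneg _).trans key) hTk
    have hbound : χ 0 ≤ T * (d / σ) * (χ 0 + e 0 ^ 2) := by
      rcases hΔ.eq_or_lt with h0 | hpos
      · rw [← h0, mul_zero] at key
        have hE : e T = e 0 := sub_eq_zero.1 (pow_eq_zero_iff two_ne_zero |>.1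
          (le_antisymm key (sq_nonneg _)))
        rw [hE] at h0
        have : χ 0 = 0 := by linarith
        have := mul_pos hTk hV0
        linarith
      · refine le_of_mul_le_mul_right ?_ hpos
        nlinarith [mul_le_mul_of_nonneg_left key hV0.le,
          sq_nonneg (e 0 * e T - (χ 0 + e 0 ^ 2))]
    have hfrac : 1 - e 0 ^ 2 / (χ 0 + e 0 ^ 2) = χ 0 / (χ 0 + e 0 ^ 2) := by
      field_simp
      ring
    calc σ / d * (1 - e 0 ^ 2 / (χ 0 + e 0 ^ 2))
        ≤ σ / d * (T * (d / σ)) := by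
          rw [hfrac]
          gcongr
          rwa [div_le_iff₀ hV0]
      _ = T := by field_simp
  · intro h1 h2
    rw [h1, h2] at key
    have hE : 0 < e T ^ 2 := by positivity
    have h : 1 ≤ T * (d / σ) := le_of_mul_le_mul_right (by linarith) hE
    calc σ / d ≤ σ / d * (T * (d / σ)) := le_mul_of_one_le_right (by positivity) h
      _ = T := by field_simp
end

section
/- (Robust minimum inter-event time, Theorem 3.) Define h(χ, e) = (σ/d)(1 - e²/(χ + e²)) for (χ, e) ≠ (0,0) and h(0,0) = σ/d. Let Δ ∈ [0, σ/d), let T > 0, and let (χ, e) be a solution of the local event-clock system on [0, T] for some continuous input μ, with initial condition χ(0) = 0, e(0) = 0. If (χ(T), e(T)) ≠ (0,0), χ(T) ≥ 0, and h(χ(T), e(T)) ≤ Δ (the robust trigger condition is satisfied at time T), then T ≥ σ/d - Δ > 0. Hence the inter-event times of agent i under the robust event trigger hᵢ(vᵢ) ≤ Δᵢ are lower bounded by T̃ᵢ = σᵢ/dᵢ - Δᵢ > 0. -/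
open scoped BigOperators

/-- A consequence of Cauchy-Schwarz: a weighted completed square is nonnegative. -/
theorem sum_mul_sq_completed_nonneg {m : ℕ} {w : Fin m → ℝ} (hw : ∀ j, 0 ≤ w j)
    (x : Fin m → ℝ) (c : ℝ) :
    0 ≤ (∑ j, w j) * (∑ j, w j * x j ^ 2) - 2 * c * (∑ j, w j * x j) + c ^ 2 := by
  have hcs : (∑ j, w j * x j) ^ 2 ≤ (∑ j, w j) * (∑ j, w j * x j ^ 2) :=
    Finset.sum_sq_le_sum_mul_sum_of_sq_le_mul Finset.univ (fun j _ => hw j)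
      (fun j _ => mul_nonneg (hw j) (sq_nonneg _)) (fun j _ => le_of_eq (by ring))
  nlinarith [sq_nonneg ((∑ j, w j * x j) - c)]

/-- Along a solution started at the origin, `σ e(T)² ≤ T d (χ(T) + e(T)²)`. -/
theorem broadcast_error_sq_le {m : ℕ} {σ : ℝ} (hσ : 0 < σ)
    {w : Fin m → ℝ} (hw : ∀ j, 0 ≤ w j) {μ : ℝ → Fin m → ℝ}
    {T : ℝ} (hT : 0 < T) {χ e : ℝ → ℝ}
    (hχ : ∀ t ∈ Set.Icc (0 : ℝ) T, HasDerivAt χ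
      (σ * (∑ j, w j * (μ t j) ^ 2) + 2 * e t * (∑ j, w j * μ t j)) t)
    (he : ∀ t ∈ Set.Icc (0 : ℝ) T, HasDerivAt e (-(∑ j, w j * μ t j)) t)
    (hχ0 : χ 0 = 0) (he0 : e 0 = 0) :
    σ * e T ^ 2 ≤ T * (∑ j, w j) * (χ T + e T ^ 2) := by
  set d := ∑ j, w j with hd
  have key (c : ℝ) : 0 ≤ d * (χ T + e T ^ 2) + σ * (2 * c * e T + c ^ 2 * T) := by
    have hderiv : ∀ t ∈ Set.Icc (0 : ℝ) T,
        HasDerivAt (fun t => d * (χ t + e t ^ 2) + σ * (2 * c * e t + c ^ 2 * t))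
          (σ * (d * (∑ j, w j * μ t j ^ 2) - 2 * c * (∑ j, w j * μ t j) + c ^ 2)) t := by
      intro t ht
      have h1 := (((hχ t ht).add ((he t ht).pow 2)).const_mul d).add
        ((((he t ht).const_mul (2 * c)).add ((hasDerivAt_id t).const_mul (c ^ 2))).const_mul σ)
      refine h1.congr_deriv ?_
      push_cast
      ring
    have hmono := monotoneOn_of_hasDerivWithinAt_nonneg (convex_Icc (0 : ℝ) T)
      (fun t ht => (hderiv t ht).continuousAt.continuousWithinAt)
      (fun t ht => (hderiv t (interior_subset ht)).hasDerivWithinAt)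
      (fun t _ => mul_nonneg hσ.le (sum_mul_sq_completed_nonneg hw (μ t) c))
    simpa [hχ0, he0] using
      hmono (Set.left_mem_Icc.2 hT.le) (Set.right_mem_Icc.2 hT.le) hT.le
  have hmul := mul_nonneg hT.le (key (-e T / T))
  have heq : T * (d * (χ T + e T ^ 2) + σ * (2 * (-e T / T) * e T + (-e T / T) ^ 2 * T))
      = T * d * (χ T + e T ^ 2) - σ * e T ^ 2 := by
    field_simp
    ring
  linarith

/-- **Theorem 3: robust minimum inter-event time.**
Define `h(χ, e) = (σ/d)(1 - e²/(χ + e²))` for `(χ, e) ≠ (0,0)` and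
`h(0,0) = σ/d`. If `Δ ∈ [0, σ/d)`, `(χ, e)` solves the local event-clock system
on `[0, T]` starting from `χ(0) = 0`, `e(0) = 0`, and at time `T > 0` the robust
trigger condition holds, i.e. `(χ(T), e(T)) ≠ (0,0)`, `χ(T) ≥ 0`, and
`h(χ(T), e(T)) ≤ Δ`, then `T ≥ σ/d - Δ > 0`. -/
theorem robust_MIET
    (m : ℕ) (hm : 1 ≤ m) (σ : ℝ) (hσ : σ ∈ Set.Ioo (0 : ℝ) 1)
    (w : Fin m → ℝ) (hw : ∀ j, 0 < w j)
    (d : ℝ) (hd : d = ∑ j, w j)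
    (h : ℝ → ℝ → ℝ)
    (hh : ∀ a b : ℝ, (a, b) ≠ ((0 : ℝ), (0 : ℝ)) →
      h a b = σ / d * (1 - b ^ 2 / (a + b ^ 2)))
    (hh0 : h 0 0 = σ / d)
    (Δ : ℝ) (hΔ : Δ ∈ Set.Ico (0 : ℝ) (σ / d))
    (μ : ℝ → Fin m → ℝ) (hμ : ∀ j, Continuous (fun t => μ t j))
    (T : ℝ) (hT : 0 < T) (χ e : ℝ → ℝ)
    (hχ : ∀ t ∈ Set.Icc (0 : ℝ) T, HasDerivAt χ
      (σ * (∑ j, w j * (μ t j) ^ 2) + 2 * e t * (∑ j, w j * μ t j)) t)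
    (he : ∀ t ∈ Set.Icc (0 : ℝ) T, HasDerivAt e (-(∑ j, w j * μ t j)) t)
    (hχ0 : χ 0 = 0) (he0 : e 0 = 0)
    (hne : (χ T, e T) ≠ ((0 : ℝ), (0 : ℝ)))
    (hχT : 0 ≤ χ T)
    (htrig : h (χ T) (e T) ≤ Δ) :
    σ / d - Δ ≤ T ∧ 0 < σ / d - Δ := by
  refine ⟨?_, sub_pos.2 hΔ.2⟩
  have hdpos : 0 < d := by
    have : Nonempty (Fin m) := ⟨⟨0, hm⟩⟩
    exact hd ▸ Finset.sum_pos (fun j _ => hw j) Finset.univ_nonempty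
  have hV : 0 < χ T + e T ^ 2 := by
    by_cases h0 : e T = 0
    · have : χ T ≠ 0 := fun h1 => hne (by rw [h1, h0])
      positivity
    · positivity
  have hle := broadcast_error_sq_le hσ.1 (fun j => (hw j).le) hT hχ he hχ0 he0
  rw [← hd] at hle
  have hratio : σ / d * (e T ^ 2 / (χ T + e T ^ 2)) ≤ T := by
    rw [div_mul_div_comm, div_le_iff₀ (mul_pos hdpos hV)]
    linarith
  rw [hh _ _ hne, mul_sub, mul_one] at htrig
  linarith
end
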